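/- arXiv:2108.04737 — 3 statements merged into one kernel-verified Lean document; each statement's English description precedes it below -/
import Mathlib

section
/- Within-transformation reduction of the first-order conditions: let Z be a real N×n matrix and W a real symmetric N×N matrix such that ZᵀWZ is invertible, set P = Z(ZᵀWZ)⁻¹ZᵀW and M = I_N − P, let X be a real N×p matrix and y ∈ ℝ^N. Suppose β̂ ∈ ℝ^p and α̂ ∈ ℝ^n satisfy the first-order conditions Xᵀ·W·(y − X·β̂ − Z·α̂) = 0 and Zᵀ·W·(y − X·β̂ − Z·α̂) = 0. Then Z·α̂ = P·(y − X·β̂) and Xᵀ·Mᵀ·W·M·(y − X·β̂) = 0; consequently, if the p×p matrix Xᵀ·Mᵀ·W·M·X is invertible, then β̂ = (Xᵀ·Mᵀ·W·M·X)⁻¹·Xᵀ·Mᵀ·W·M·y. -/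
open Matrix

/-- Within-transformation reduction of the first-order conditions: if `β̂, α̂` satisfy
`XᵀW(y − Xβ̂ − Zα̂) = 0` and `ZᵀW(y − Xβ̂ − Zα̂) = 0`, then `Zα̂ = P(y − Xβ̂)` and
`XᵀMᵀWM(y − Xβ̂) = 0`; consequently, if `XᵀMᵀWMX` is invertible, then
`β̂ = (XᵀMᵀWMX)⁻¹XᵀMᵀWMy`. -/
theorem within_transformation_first_order
    (N n p : ℕ) (Z : Matrix (Fin N) (Fin n) ℝ) (W : Matrix (Fin N) (Fin N) ℝ)
    (hW : W.IsSymm) (hZWZ : IsUnit (Zᵀ * W * Z).det)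
    (P M : Matrix (Fin N) (Fin N) ℝ)
    (hP : P = Z * (Zᵀ * W * Z)⁻¹ * Zᵀ * W) (hM : M = 1 - P)
    (X : Matrix (Fin N) (Fin p) ℝ) (y : Fin N → ℝ) (βhat : Fin p → ℝ)
    (αhat : Fin n → ℝ)
    (hX : (Xᵀ * W) *ᵥ (y - X *ᵥ βhat - Z *ᵥ αhat) = 0)
    (hZ : (Zᵀ * W) *ᵥ (y - X *ᵥ βhat - Z *ᵥ αhat) = 0) :
    Z *ᵥ αhat = P *ᵥ (y - X *ᵥ βhat) ∧
      (Xᵀ * Mᵀ * W * M) *ᵥ (y - X *ᵥ βhat) = 0 ∧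
      (IsUnit (Xᵀ * Mᵀ * W * M * X).det →
        βhat = (Xᵀ * Mᵀ * W * M * X)⁻¹ *ᵥ ((Xᵀ * Mᵀ * W * M) *ᵥ y)) := by
  have hZα : Z *ᵥ αhat = P *ᵥ (y - X *ᵥ βhat) := by
    have hnormal : (Zᵀ * W) *ᵥ (y - X *ᵥ βhat) = (Zᵀ * W * Z) *ᵥ αhat := by
      rw [mulVec_sub, sub_eq_zero, mulVec_mulVec] at hZ
      exact hZ
    rw [hP, Matrix.mul_assoc (Z * _), ← mulVec_mulVec, hnormal, mulVec_mulVec, Matrix.mul_assoc,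
      nonsing_inv_mul _ hZWZ, Matrix.mul_one]
  have hMr : M *ᵥ (y - X *ᵥ βhat) = y - X *ᵥ βhat - Z *ᵥ αhat := by
    rw [hM, sub_mulVec, one_mulVec, hZα]
  have hPres : (Pᵀ * W) *ᵥ (y - X *ᵥ βhat - Z *ᵥ αhat) = 0 := by
    have hfactor : Pᵀ * W = Wᵀ * Z * ((Zᵀ * W * Z)⁻¹)ᵀ * (Zᵀ * W) := by
      simp only [hP, transpose_mul, transpose_transpose, Matrix.mul_assoc]
    rw [hfactor, ← mulVec_mulVec, hZ, mulVec_zero]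
  have hfoc : (Xᵀ * Mᵀ * W * M) *ᵥ (y - X *ᵥ βhat) = 0 := by
    have hsplit : Xᵀ * Mᵀ * W = Xᵀ * W - Xᵀ * (Pᵀ * W) := by
      rw [hM, transpose_sub, transpose_one, Matrix.mul_sub, Matrix.sub_mul, Matrix.mul_one,
        Matrix.mul_assoc Xᵀ Pᵀ]
    rw [← mulVec_mulVec, hMr, hsplit, sub_mulVec, hX, ← mulVec_mulVec, hPres, mulVec_zero, sub_zero]
  refine ⟨hZα, hfoc, fun hdet => ?_⟩
  rw [mulVec_sub, sub_eq_zero, mulVec_mulVec] at hfoc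
  rw [hfoc, mulVec_mulVec, nonsing_inv_mul _ hdet, one_mulVec]
end

section
/- Block inverse (Frisch–Waugh–Lovell) identity: let W be a real symmetric N×N matrix, Z a real N×n matrix with ZᵀWZ invertible, X a real N×p matrix; set M = I_N − Z(ZᵀWZ)⁻¹ZᵀW and suppose the p×p matrix Xᵀ·Mᵀ·W·M·X is invertible. Then the (n+p)×(n+p) block matrix A = [[ZᵀWZ, ZᵀWX],[XᵀWZ, XᵀWX]] is invertible and the lower-right p×p block of A⁻¹ equals (Xᵀ·Mᵀ·W·M·X)⁻¹. -/
open Matrix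

namespace Matrix

variable {N n m R : Type*} [Fintype N] [Fintype n] [Fintype m] [DecidableEq N] [DecidableEq n]
  [DecidableEq m] [CommRing R]

/-- The residual-maker matrix is `W`-orthogonal to the columns of `Z`. -/
theorem transpose_mul_mul_residual_eq_zero (Z : Matrix N n R) (W : Matrix N N R)
    (h : IsUnit (Zᵀ * W * Z).det) :
    Zᵀ * W * (1 - Z * (Zᵀ * W * Z)⁻¹ * Zᵀ * W) = 0 := by
  have hinv := mul_nonsing_inv _ h
  calc Zᵀ * W * (1 - Z * (Zᵀ * W * Z)⁻¹ * Zᵀ * W)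
      = Zᵀ * W - (Zᵀ * W * Z) * (Zᵀ * W * Z)⁻¹ * (Zᵀ * W) := by
        simp only [Matrix.mul_sub, Matrix.mul_one, Matrix.mul_assoc]
    _ = 0 := by rw [hinv, Matrix.one_mul, sub_self]

theorem residual_transpose_mul_mul_residual (Z : Matrix N n R) (W : Matrix N N R)
    (h : IsUnit (Zᵀ * W * Z).det) :
    (1 - Z * (Zᵀ * W * Z)⁻¹ * Zᵀ * W)ᵀ * W * (1 - Z * (Zᵀ * W * Z)⁻¹ * Zᵀ * W) =
      W * (1 - Z * (Zᵀ * W * Z)⁻¹ * Zᵀ * W) := by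
  have h0 := transpose_mul_mul_residual_eq_zero Z W h
  have ht : (1 - Z * (Zᵀ * W * Z)⁻¹ * Zᵀ * W)ᵀ =
      1 - Wᵀ * Z * ((Zᵀ * W * Z)⁻¹)ᵀ * Zᵀ := by
    rw [transpose_sub, transpose_one]
    simp only [transpose_mul, transpose_transpose, Matrix.mul_assoc]
  rw [ht]
  generalize 1 - Z * (Zᵀ * W * Z)⁻¹ * Zᵀ * W = M at h0 ⊢
  rw [Matrix.sub_mul, Matrix.one_mul, Matrix.sub_mul, Matrix.mul_assoc _ Zᵀ W,
    Matrix.mul_assoc _ (Zᵀ * W) M, h0, Matrix.mul_zero, sub_zero]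

/-- If a diagonal block and its Schur complement are invertible, so is the block matrix, and the
opposite diagonal block of its inverse is the inverse of the Schur complement. -/
theorem isUnit_det_fromBlocks_and_toBlocks₂₂_inv (A : Matrix n n R) (B : Matrix n m R)
    (C : Matrix m n R) (D : Matrix m m R) (hA : IsUnit A.det)
    (hS : IsUnit (D - C * A⁻¹ * B).det) :
    IsUnit (fromBlocks A B C D).det ∧
      (fromBlocks A B C D)⁻¹.toBlocks₂₂ = (D - C * A⁻¹ * B)⁻¹ := by
  let := A.invertibleOfIsUnitDet hA
  rw [← invOf_eq_nonsing_inv A] at hS ⊢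
  let := (D - C * ⅟A * B).invertibleOfIsUnitDet hS
  let := fromBlocks₁₁Invertible A B C D
  refine ⟨isUnit_det_of_invertible _, ?_⟩
  rw [← invOf_eq_nonsing_inv, invOf_fromBlocks₁₁_eq, toBlocks_fromBlocks₂₂, invOf_eq_nonsing_inv]

end Matrix

/-- Block inverse (Frisch–Waugh–Lovell) identity: with `M = I − Z(ZᵀWZ)⁻¹ZᵀW`, if
`XᵀMᵀWMX` is invertible then the block matrix `A = [[ZᵀWZ, ZᵀWX],[XᵀWZ, XᵀWX]]` is
invertible and the lower-right `p×p` block of `A⁻¹` equals `(XᵀMᵀWMX)⁻¹`. -/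
theorem block_inverse_fwl
    (N n p : ℕ) (Z : Matrix (Fin N) (Fin n) ℝ) (W : Matrix (Fin N) (Fin N) ℝ)
    (hW : W.IsSymm) (hZWZ : IsUnit (Zᵀ * W * Z).det)
    (X : Matrix (Fin N) (Fin p) ℝ)
    (M : Matrix (Fin N) (Fin N) ℝ) (hM : M = 1 - Z * (Zᵀ * W * Z)⁻¹ * Zᵀ * W)
    (hS : IsUnit (Xᵀ * Mᵀ * W * M * X).det)
    (A : Matrix (Fin n ⊕ Fin p) (Fin n ⊕ Fin p) ℝ)
    (hA : A = Matrix.fromBlocks (Zᵀ * W * Z) (Zᵀ * W * X) (Xᵀ * W * Z) (Xᵀ * W * X)) :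
    IsUnit A.det ∧ (A⁻¹).toBlocks₂₂ = (Xᵀ * Mᵀ * W * M * X)⁻¹ := by
  have hSchur : Xᵀ * Mᵀ * W * M * X =
      Xᵀ * W * X - Xᵀ * W * Z * (Zᵀ * W * Z)⁻¹ * (Zᵀ * W * X) := by
    have hMWM : Mᵀ * W * M = W * M := by
      rw [hM]
      exact residual_transpose_mul_mul_residual Z W hZWZ
    calc Xᵀ * Mᵀ * W * M * X = Xᵀ * (Mᵀ * W * M) * X := by simp only [Matrix.mul_assoc]
      _ = _ := by
        rw [hMWM, hM]
        simp only [Matrix.mul_sub, Matrix.sub_mul, Matrix.mul_one, Matrix.mul_assoc]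
  rw [hSchur] at hS ⊢
  rw [hA]
  exact isUnit_det_fromBlocks_and_toBlocks₂₂_inv _ _ _ _ hZWZ hS
end

section
/- Finite-dimensional form of the sandwich block identity (Lemma 1): let W and Σ be real symmetric N×N matrices, Z a real N×n matrix with ZᵀWZ invertible, X a real N×p matrix; set M = I_N − Z(ZᵀWZ)⁻¹ZᵀW and suppose Xᵀ·Mᵀ·W·M·X is invertible. Define the (n+p)×(n+p) block matrices A = [[ZᵀWZ, ZᵀWX],[XᵀWZ, XᵀWX]] and B = [[ZᵀΣZ, ZᵀΣX],[XᵀΣZ, XᵀΣX]]. Then the lower-right p×p block of A⁻¹·B·A⁻¹ equals (Xᵀ·Mᵀ·W·M·X)⁻¹ · (Xᵀ·Mᵀ·Σ·M·X) · (Xᵀ·Mᵀ·W·M·X)⁻¹. -/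
open Matrix

/-- Inverse of a block matrix presented through its block `LDLᵀ` factorization. -/
theorem inv_fromBlocks_of_factorization {m l R : Type*} [Fintype m] [Fintype l]
    [DecidableEq m] [DecidableEq l] [CommRing R] (D : Matrix m m R) (S : Matrix l l R)
    (K : Matrix m l R) (L : Matrix l m R) (hD : IsUnit D.det) (hS : IsUnit S.det) :
    (fromBlocks D (D * K) (L * D) (S + L * D * K))⁻¹ =
      fromBlocks (D⁻¹ + K * S⁻¹ * L) (-(K * S⁻¹)) (-(S⁻¹ * L)) S⁻¹ := by
  apply inv_eq_right_inv
  rw [fromBlocks_multiply, ← fromBlocks_one]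
  congr 1
  · simp [Matrix.mul_add, Matrix.mul_assoc, mul_nonsing_inv D hD]
  · simp [Matrix.mul_assoc]
  · simp [Matrix.mul_add, Matrix.add_mul, Matrix.mul_assoc, mul_nonsing_inv D hD,
      mul_nonsing_inv_cancel_left S _ hS]
  · simp [Matrix.add_mul, Matrix.mul_assoc, mul_nonsing_inv S hS]

/-- Finite-dimensional sandwich block identity (Lemma 1): with
`M = I − Z(ZᵀWZ)⁻¹ZᵀW`, `A = [[ZᵀWZ, ZᵀWX],[XᵀWZ, XᵀWX]]` and
`B = [[ZᵀΣZ, ZᵀΣX],[XᵀΣZ, XᵀΣX]]` (where `Σ` is denoted `Sig`), the lower-right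
`p×p` block of `A⁻¹·B·A⁻¹` equals `(XᵀMᵀWMX)⁻¹·(XᵀMᵀΣMX)·(XᵀMᵀWMX)⁻¹`. -/
theorem sandwich_block_identity
    (N n p : ℕ) (Z : Matrix (Fin N) (Fin n) ℝ) (W Sig : Matrix (Fin N) (Fin N) ℝ)
    (hW : W.IsSymm) (hSig : Sig.IsSymm) (hZWZ : IsUnit (Zᵀ * W * Z).det)
    (X : Matrix (Fin N) (Fin p) ℝ)
    (M : Matrix (Fin N) (Fin N) ℝ) (hM : M = 1 - Z * (Zᵀ * W * Z)⁻¹ * Zᵀ * W)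
    (hS : IsUnit (Xᵀ * Mᵀ * W * M * X).det)
    (A B : Matrix (Fin n ⊕ Fin p) (Fin n ⊕ Fin p) ℝ)
    (hA : A = Matrix.fromBlocks (Zᵀ * W * Z) (Zᵀ * W * X) (Xᵀ * W * Z) (Xᵀ * W * X))
    (hB : B = Matrix.fromBlocks (Zᵀ * Sig * Z) (Zᵀ * Sig * X)
      (Xᵀ * Sig * Z) (Xᵀ * Sig * X)) :
    (A⁻¹ * B * A⁻¹).toBlocks₂₂ =
      (Xᵀ * Mᵀ * W * M * X)⁻¹ * (Xᵀ * Mᵀ * Sig * M * X) * (Xᵀ * Mᵀ * W * M * X)⁻¹ := by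
  set D := Zᵀ * W * Z with hD
  set K := D⁻¹ * (Zᵀ * W * X) with hK
  have hDt : Dᵀ = D := by
    simp [hD, Matrix.mul_assoc, hW.eq]
  have hKt : Kᵀ = Xᵀ * W * Z * D⁻¹ := by
    simp [hK, transpose_nonsing_inv, hDt, Matrix.mul_assoc, hW.eq]
  have hDK : D * K = Zᵀ * W * X := mul_nonsing_inv_cancel_left D _ hZWZ
  have hKD : Kᵀ * D = Xᵀ * W * Z := by
    rw [hKt, nonsing_inv_mul_cancel_right D _ hZWZ]
  have hMX : M * X = X - Z * K := by
    simp [hM, hK, Matrix.sub_mul, Matrix.mul_assoc]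
  have hquad : ∀ T : Matrix (Fin N) (Fin N) ℝ, Xᵀ * Mᵀ * T * M * X =
      Xᵀ * T * X - Xᵀ * T * Z * K - Kᵀ * (Zᵀ * T * X) + Kᵀ * (Zᵀ * T * Z) * K := by
    intro T
    have h : Xᵀ * Mᵀ * T * M * X = (M * X)ᵀ * T * (M * X) := by
      simp [Matrix.mul_assoc]
    rw [h, hMX]
    simp only [transpose_sub, transpose_mul, Matrix.sub_mul, Matrix.mul_sub, Matrix.mul_assoc]
    abel
  have hXWX : Xᵀ * W * X = Xᵀ * Mᵀ * W * M * X + Kᵀ * D * K := by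
    rw [hquad W, ← hD, ← hDK, ← hKD, Matrix.mul_assoc Kᵀ D K]
    abel
  have hAinv := inv_fromBlocks_of_factorization D _ K Kᵀ hZWZ hS
  rw [← hXWX, hDK, hKD, ← hA] at hAinv
  rw [hAinv, hB, hquad Sig, fromBlocks_multiply, fromBlocks_multiply, toBlocks_fromBlocks₂₂]
  simp only [Matrix.mul_add, Matrix.add_mul, Matrix.mul_sub, Matrix.sub_mul, Matrix.neg_mul,
    Matrix.mul_neg, Matrix.mul_assoc]
  abel
end
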